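/- Let G be a finite simple graph, let m ≥ 1 be an integer, and let s_1, …, s_{m²} be pairwise distinct vertices of G. Suppose that for every pair 1 ≤ i < j ≤ m² there is a path P_{ij} in G with endpoints s_i and s_j, such that whenever the four indices i, j, ℓ, p are pairwise distinct, the paths P_{ij} and P_{ℓp} have no vertex in common. Then G contains a K_m-minor. -/

import Mathlib

/-- `G` contains a `K_m`-minor. -/
def HasCliqueMinor {V : Type*} (G : SimpleGraph V) (m : ℕ) : Prop :=
  ∃ f : Fin m → Set V, (∀ i, (f i).Nonempty) ∧
    (∀ i j, i ≠ j → Disjoint (f i) (f j)) ∧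
    (∀ i, (G.induce (f i)).Connected) ∧
    (∀ i j, i ≠ j → ∃ u ∈ f i, ∃ v ∈ f j, G.Adj u v)

lemma cm_first_entry {V : Type*} {G : SimpleGraph V} (B : Set V) {u v : V} (w : G.Walk u v)
    (hu : u ∉ B) (hv : v ∈ B) : ∃ (x : V) (q : G.Walk u x), (∀ z ∈ q.support, z ∈ w.support) ∧
      (∀ z ∈ q.support, z ∉ B) ∧ ∃ y ∈ B, G.Adj x y := by
  induction w with
  | nil => exact absurd hv hu
  | @cons a b c h p ih =>
    by_cases hb : b ∈ B
    · exact ⟨a, .nil, by simp, by simpa using hu, b, hb, h⟩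
    · obtain ⟨x, q, h1, h2, y, hy, hxy⟩ := ih hb hv
      refine ⟨x, .cons h q, ?_, ?_, y, hy, hxy⟩
      · intro z hz
        simp only [SimpleGraph.Walk.support_cons, List.mem_cons] at hz ⊢
        exact hz.imp id (h1 z)
      · intro z hz
        simp only [SimpleGraph.Walk.support_cons, List.mem_cons] at hz
        rcases hz with rfl | hz
        · exact hu
        · exact h2 z hz

lemma cm_connected {V : Type*} {G : SimpleGraph V} (S : Set V) (u : V) (hu : u ∈ S)
    (h : ∀ x ∈ S, ∃ w : G.Walk u x, ∀ z ∈ w.support, z ∈ S) : (G.induce S).Connected := by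
  have key : ∀ x : S, (G.induce S).Reachable ⟨u, hu⟩ x := by
    rintro ⟨x, hx⟩
    obtain ⟨w, hw⟩ := h x hx
    exact ⟨w.induce S hw⟩
  haveI : Nonempty S := ⟨⟨u, hu⟩⟩
  exact ⟨fun x y => (key x).symm.trans (key y)⟩

lemma cm_core {V : Type*} (G : SimpleGraph V) (m : ℕ) (hm : 2 ≤ m)
    (s : Fin m × Fin m → V)
    (Q : ∀ i j : Fin m × Fin m, G.Walk (s i) (s j))
    (hQ : ∀ i j l p : Fin m × Fin m, i ≠ j → l ≠ p → i ≠ l → i ≠ p → j ≠ l → j ≠ p →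
      ∀ x : V, x ∈ (Q i j).support → x ∉ (Q l p).support) : HasCliqueMinor G m := by
  classical
  haveI : Nontrivial (Fin m) := Fin.nontrivial_iff_two_le.2 hm
  let R : Fin m → Set V := fun a => {x | ∃ b, b ≠ a ∧ x ∈ (Q (a, a) (a, b)).support}
  have hsR : ∀ a b, s (a, b) ∈ R a := by
    intro a b
    by_cases hb : b = a
    · subst hb
      obtain ⟨c, hc⟩ := exists_ne b
      exact ⟨c, hc, SimpleGraph.Walk.start_mem_support _⟩
    · exact ⟨b, hb, SimpleGraph.Walk.end_mem_support _⟩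
  have hRR : ∀ a b, a ≠ b → ∀ x ∈ R a, x ∉ R b := by
    rintro a b hab x ⟨c, hc, hx⟩ ⟨d, hd, hx'⟩
    refine hQ _ _ _ _ ?_ ?_ ?_ ?_ ?_ ?_ x hx hx' <;> grind
  have hLR : ∀ a b c, a ≠ b → c ≠ a → c ≠ b → ∀ x ∈ (Q (a, b) (b, a)).support, x ∉ R c := by
    rintro a b c hab hca hcb x hx ⟨d, hd, hx'⟩
    refine hQ _ _ _ _ ?_ ?_ ?_ ?_ ?_ ?_ x hx hx' <;> grind
  have hseg : ∀ a b, ∃ (x : V) (q : G.Walk (s (a, b)) x), a ≠ b →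
      (∀ z ∈ q.support, z ∈ (Q (a, b) (b, a)).support) ∧
      (∀ z ∈ q.support, z ∉ R b) ∧ ∃ y ∈ R b, G.Adj x y := by
    intro a b
    by_cases hab : a = b
    · exact ⟨_, .nil, fun h => absurd hab h⟩
    · obtain ⟨x, q, h⟩ :=
        cm_first_entry (R b) (Q (a, b) (b, a)) (hRR a b hab _ (hsR a b)) (hsR b a)
      exact ⟨x, q, fun _ => h⟩
  choose e q hq using hseg
  have hq1 := fun a b h => (hq a b h).1
  have hq2 := fun a b h => (hq a b h).2.1
  have hq3 := fun a b h => (hq a b h).2.2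
  let f : Fin m → Set V := fun a => {x | x ∈ R a ∨ ∃ b, a < b ∧ x ∈ (q a b).support}
  have hdis : ∀ a b, a < b → ∀ x ∈ f a, x ∉ f b := by
    rintro a b hab x (hx | ⟨c, hc, hx⟩) (hx' | ⟨d, hd, hx'⟩)
    · exact hRR a b hab.ne x hx hx'
    · exact hLR b d a hd.ne hab.ne (hab.trans hd).ne x (hq1 b d hd.ne x hx') hx
    · by_cases hcb : c = b
      · subst hcb
        exact hq2 a c hc.ne x hx hx'
      · exact hLR a c b hc.ne hab.ne' (Ne.symm hcb) x (hq1 a c hc.ne x hx) hx'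
    · refine hQ (a, c) (c, a) (b, d) (d, b) ?_ ?_ ?_ ?_ ?_ ?_ x (hq1 a c hc.ne x hx)
        (hq1 b d hd.ne x hx') <;> grind
  have hadj : ∀ a b, a < b → ∃ u ∈ f a, ∃ v ∈ f b, G.Adj u v := by
    intro a b hab
    obtain ⟨y, hy, hxy⟩ := hq3 a b hab.ne
    exact ⟨e a b, Or.inr ⟨b, hab, SimpleGraph.Walk.end_mem_support _⟩, y, Or.inl hy, hxy⟩
  have hwR : ∀ a, ∀ x ∈ R a, ∃ w : G.Walk (s (a, a)) x, ∀ z ∈ w.support, z ∈ f a := by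
    rintro a x ⟨b, hb, hx⟩
    exact ⟨(Q (a, a) (a, b)).takeUntil x hx, fun z hz =>
      Or.inl ⟨b, hb, SimpleGraph.Walk.support_takeUntil_subset _ hx hz⟩⟩
  refine ⟨f, fun a => ⟨s (a, a), Or.inl (hsR a a)⟩, ?_, ?_, ?_⟩
  · intro a b hab
    rw [Set.disjoint_left]
    intro x hx hx'
    rcases lt_or_gt_of_ne hab with h | h
    · exact hdis a b h x hx hx'
    · exact hdis b a h x hx' hx
  · intro a
    refine cm_connected (f a) (s (a, a)) (Or.inl (hsR a a)) ?_
    rintro x (hx | ⟨b, hb, hx⟩)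
    · exact hwR a x hx
    · obtain ⟨w, hw⟩ := hwR a _ (hsR a b)
      refine ⟨w.append ((q a b).takeUntil x hx), fun z hz => ?_⟩
      rw [SimpleGraph.Walk.mem_support_append_iff] at hz
      rcases hz with hz | hz
      · exact hw z hz
      · exact Or.inr ⟨b, hb, SimpleGraph.Walk.support_takeUntil_subset _ hx hz⟩
  · intro a b hab
    rcases lt_or_gt_of_ne hab with h | h
    · exact hadj a b h
    · obtain ⟨u, hu, v, hv, huv⟩ := hadj b a h
      exact ⟨v, hv, u, hu, huv.symm⟩



/-- If `m²` distinct vertices `s_1, …, s_{m²}` are pairwise joined by paths `P_{ij}`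
(`i < j`) such that paths between index-disjoint pairs are vertex-disjoint, then the graph
contains a `K_m`-minor. -/
theorem clique_minor_of_pairwise_paths {V : Type*} [Fintype V] (G : SimpleGraph V)
    (m : ℕ) (hm : 1 ≤ m) (s : Fin (m ^ 2) → V) (hs : Function.Injective s)
    (P : ∀ i j : Fin (m ^ 2), i < j → G.Walk (s i) (s j))
    (hpath : ∀ (i j : Fin (m ^ 2)) (hij : i < j), (P i j hij).IsPath)
    (hdisj : ∀ (i j l p : Fin (m ^ 2)) (hij : i < j) (hlp : l < p),
      i ≠ l → i ≠ p → j ≠ l → j ≠ p →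
      ∀ x : V, x ∈ (P i j hij).support → x ∉ (P l p hlp).support) :
    HasCliqueMinor G m := by
  classical
  by_cases h2 : 2 ≤ m
  · let e : Fin m × Fin m ≃ Fin (m ^ 2) := finProdFinEquiv.trans (finCongr (sq m).symm)
    have hW : ∀ i j : Fin (m ^ 2), ∃ w : G.Walk (s i) (s j), i ≠ j → ∃ (a b : Fin (m ^ 2)) (hab : a < b),
        (a = i ∧ b = j ∨ a = j ∧ b = i) ∧ ∀ x ∈ w.support, x ∈ (P a b hab).support := by
      intro i j
      rcases lt_trichotomy i j with h | h | h
      · exact ⟨P i j h, fun _ => ⟨i, j, h, Or.inl ⟨rfl, rfl⟩, fun x hx => hx⟩⟩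
      · subst h
        exact ⟨.nil, fun h => absurd rfl h⟩
      · exact ⟨(P j i h).reverse, fun _ => ⟨j, i, h, Or.inr ⟨rfl, rfl⟩, fun x hx => by simpa using hx⟩⟩
    choose W hW using hW
    refine cm_core G m h2 (fun i => s (e i)) (fun i j => W (e i) (e j)) ?_
    intro i j l p hij hlp hil hip hjl hjp x hx hx'
    obtain ⟨a, b, hab, h1, h1'⟩ := hW (e i) (e j) (e.injective.ne hij)
    obtain ⟨c, d, hcd, h3, h3'⟩ := hW (e l) (e p) (e.injective.ne hlp)
    have := e.injective.ne hil
    have := e.injective.ne hip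
    have := e.injective.ne hjl
    have := e.injective.ne hjp
    refine hdisj a b c d hab hcd ?_ ?_ ?_ ?_ x (h1' x hx) (h3' x hx') <;> grind
  · obtain rfl : m = 1 := by omega
    refine ⟨fun _ => {s 0}, fun _ => Set.singleton_nonempty _,
      fun i j h => absurd (Subsingleton.elim i j) h, fun i => ?_,
      fun i j h => absurd (Subsingleton.elim i j) h⟩
    refine cm_connected _ (s 0) rfl ?_
    rintro x rfl
    exact ⟨.nil, by simp⟩
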